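/- Let α be a C*-partial action of a discrete group G on a C*-algebra A satisfying property (NS). For each t ∈ G, a, b ∈ A, the limit F_t(a,b) := lim_i α_t(u_i a) b (taken over any approximate unit (u_i) of A_{t⁻¹}) is independent of the chosen approximate unit, lies in A_t, and satisfies c·F_t(a,b) = α_t(α_{t⁻¹}(c) a) b and F_t(a,b)·c = α_t(a·α_{t⁻¹}(b c)) for every c ∈ A_t. -/

import Mathlib

set_option linter.unusedSectionVars false
set_option linter.unusedVariables false

universe u v w x y

section PartialActionPrelim

variable (k : Type u) [CommRing k] (G : Type v) [Group G] (A : Type w)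
  [NonUnitalRing A] [Module k A] [SMulCommClass k A A] [IsScalarTower k A A]

/-- A partial action of a group `G` on a (not necessarily unital) `k`-algebra `A`:
a family of two-sided ideals `A_t` and algebra isomorphisms `α_t : A_{t⁻¹} → A_t`
(encoded by total functions `act t : A → A` whose behaviour only matters on `A_{t⁻¹}`). -/
structure AlgPartialAction : Type (max u v w) where
  ideal : G → Submodule k A
  act : G → A → A
  mul_mem_left : ∀ (t : G) (a : A), ∀ x ∈ ideal t, a * x ∈ ideal t
  mul_mem_right : ∀ (t : G) (a : A), ∀ x ∈ ideal t, x * a ∈ ideal t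
  ideal_one : ideal 1 = ⊤
  act_one : ∀ a : A, act 1 a = a
  act_mem : ∀ t : G, ∀ a ∈ ideal t⁻¹, act t a ∈ ideal t
  act_add : ∀ t : G, ∀ a ∈ ideal t⁻¹, ∀ b ∈ ideal t⁻¹, act t (a + b) = act t a + act t b
  act_smul : ∀ (t : G) (c : k), ∀ a ∈ ideal t⁻¹, act t (c • a) = c • act t a
  act_mul : ∀ t : G, ∀ a ∈ ideal t⁻¹, ∀ b ∈ ideal t⁻¹, act t (a * b) = act t a * act t b
  act_injOn : ∀ t : G, Set.InjOn (act t) (ideal t⁻¹ : Set A)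
  act_image : ∀ s t : G,
    act t '' ((ideal t⁻¹ : Set A) ∩ (ideal s : Set A)) = (ideal t : Set A) ∩ (ideal (t * s) : Set A)
  act_comp : ∀ s t : G, ∀ a ∈ ideal t⁻¹, act t a ∈ ideal s⁻¹ → act s (act t a) = act (s * t) a

/-- The annihilator `Ann(B) = {b ∈ B : bB = Bb = 0}`. -/
def annih (B : Type x) [NonUnitalRing B] : Set B := {b | ∀ c : B, b * c = 0 ∧ c * b = 0}

variable {k G A}

/-- An enveloping pair `(μ, β)` for a partial action `α` (in the purely algebraic sense). -/
structure EnvPair (α : AlgPartialAction k G A) (B : Type x) [NonUnitalRing B]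
    [Module k B] [SMulCommClass k B B] [IsScalarTower k B B] : Type (max u v w x) where
  β : G → B →ₙₐ[k] B
  β_one : ∀ b : B, β 1 b = b
  β_comp : ∀ (s t : G) (b : B), β (s * t) b = β s (β t b)
  μ : A →ₙₐ[k] B
  μ_inj : Function.Injective μ
  μ_mul_mem_left : ∀ b : B, ∀ x ∈ Set.range μ, b * x ∈ Set.range μ
  μ_mul_mem_right : ∀ b : B, ∀ x ∈ Set.range μ, x * b ∈ Set.range μ
  inter : ∀ t : G, ⇑μ '' (α.ideal t : Set A) = Set.range μ ∩ (⇑(β t) '' Set.range μ)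
  equivar : ∀ t : G, ∀ a ∈ α.ideal t⁻¹, β t (μ a) = μ (α.act t a)
  spans : Submodule.span k (⋃ t : G, ⇑(β t) '' Set.range μ) = ⊤

/-- An enveloping family of functions for a partial action `α` (Definition 1.7). -/
structure IsEnvFamily (α : AlgPartialAction k G A) (F : G → A → A → A) : Prop where
  mem : ∀ (t : G) (a b : A), F t a b ∈ α.ideal t
  add_left : ∀ (t : G) (a a' b : A), F t (a + a') b = F t a b + F t a' b
  add_right : ∀ (t : G) (a b b' : A), F t a (b + b') = F t a b + F t a b'
  smul_left : ∀ (t : G) (c : k) (a b : A), F t (c • a) b = c • F t a b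
  smul_right : ∀ (t : G) (c : k) (a b : A), F t a (c • b) = c • F t a b
  F_one : ∀ a b : A, F 1 a b = a * b
  cond2a : ∀ (t : G) (a b c : A), F t a (b * c) = F t a b * c
  cond2b : ∀ (t : G) (a b c : A), α.act t (F t⁻¹ (a * b) c) = a * α.act t (F t⁻¹ b c)
  cond2c : ∀ (t : G) (a b c : A), a * F t b c = α.act t (F t⁻¹ a b) * c
  cond3a : ∀ (s t : G) (a b c : A), F t (F s a b) c = F (t * s) a (F t b c)
  cond3b : ∀ (s t : G) (a b c : A), F t (α.act s⁻¹ (F s a b)) c = F t a (F (t * s⁻¹) b c)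
  cond4 : ∀ a : A, a = 0 ↔ ∀ (t : G) (b : A), F t a b = 0 ∧ F t b a = 0
  cond5a : ∀ (s t : G) (b : A), ∀ a ∈ α.ideal t⁻¹, F (s * t) a b = F s (α.act t a) b
  cond5b : ∀ (s t : G) (b : A), ∀ a ∈ α.ideal t⁻¹,
    α.act (s * t) (F (t⁻¹ * s⁻¹) b a) = α.act s (F s⁻¹ b (α.act t a))
  cond6 : ∀ (t : G) (a : A),
    (∃ b : A, ∀ (s : G) (c : A), F s a c = F (s * t) b c ∧ F s c a = α.act t (F (t⁻¹ * s) c b)) →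
    a ∈ α.ideal t

end PartialActionPrelim

section CStarPrelim

variable (G : Type u) [Group G] (A : Type v) [NonUnitalCStarAlgebra A]

/-- A C*-partial action of a (discrete) group `G` on a C*-algebra `A`: an algebraic partial
action whose ideals are closed and whose partial maps are *-preserving (i.e. *-isomorphisms
`A_{t⁻¹} → A_t`). -/
structure CStarPartialAction extends AlgPartialAction ℂ G A : Type (max u v) where
  ideal_closed : ∀ t : G, IsClosed (toAlgPartialAction.ideal t : Set A)
  act_star : ∀ t : G, ∀ a ∈ toAlgPartialAction.ideal t⁻¹,
    toAlgPartialAction.act t (star a) = star (toAlgPartialAction.act t a)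

variable {G A}

/-- An (increasing) approximate unit of the closed ideal `I`: an increasing net of positive
elements of norm at most `1` with `lim_i ‖u_i x - x‖ = 0` for all `x ∈ I`. -/
structure IsApproxUnit [PartialOrder A] [StarOrderedRing A] {ι : Type x} [Preorder ι]
    (I : Submodule ℂ A) (u : ι → A) : Prop where
  mem : ∀ i, u i ∈ I
  nonneg : ∀ i, 0 ≤ u i
  norm_le_one : ∀ i, ‖u i‖ ≤ 1
  mono : Monotone u
  approx : ∀ x ∈ I, Filter.Tendsto (fun i => ‖u i * x - x‖) Filter.atTop (nhds 0)

/-- Property (NS): for all `a, b ∈ A`, `t ∈ G` and every approximate unit `(u_i)` of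
`A_{t⁻¹}`, the net `(α_t(u_i a) b)` converges in `A`. -/
def HasNS [PartialOrder A] [StarOrderedRing A] (α : CStarPartialAction G A) : Prop :=
  ∀ (t : G) (a b : A) (ι : Type v) [Preorder ι] [IsDirected ι (· ≤ ·)] [Nonempty ι],
    ∀ u : ι → A, IsApproxUnit (α.ideal t⁻¹) u →
      ∃ x : A, Filter.Tendsto (fun i => α.act t (u i * a) * b) Filter.atTop (nhds x)

/-- A C*-enveloping pair `(μ, β)` for a C*-partial action `α` of a discrete group. -/
structure CStarEnvPair (α : CStarPartialAction G A) (B : Type w) [NonUnitalCStarAlgebra B] :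
    Type (max u v w) where
  β : G → B →ₙₐ[ℂ] B
  β_star : ∀ (t : G) (b : B), β t (star b) = star (β t b)
  β_one : ∀ b : B, β 1 b = b
  β_comp : ∀ (s t : G) (b : B), β (s * t) b = β s (β t b)
  μ : A →ₙₐ[ℂ] B
  μ_star : ∀ a : A, μ (star a) = star (μ a)
  μ_inj : Function.Injective μ
  range_closed : IsClosed (Set.range μ)
  μ_mul_mem_left : ∀ b : B, ∀ x ∈ Set.range μ, b * x ∈ Set.range μ
  μ_mul_mem_right : ∀ b : B, ∀ x ∈ Set.range μ, x * b ∈ Set.range μ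
  inter : ∀ t : G, ⇑μ '' (α.ideal t : Set A) = Set.range μ ∩ (⇑(β t) '' Set.range μ)
  equivar : ∀ t : G, ∀ a ∈ α.ideal t⁻¹, β t (μ a) = μ (α.act t a)
  dense_span : Dense
    ((Submodule.span ℂ (⋃ t : G, ⇑(β t) '' Set.range μ) : Submodule ℂ B) : Set B)

end CStarPrelim

open Filter Topology

/-- The largest star-closed part `I ∩ I*` of a left ideal `I`, as a star subalgebra. -/
def Submodule.starCore {A : Type*} [NonUnitalCStarAlgebra A] (I : Submodule ℂ A)
    (hI : ∀ a : A, ∀ x ∈ I, a * x ∈ I) : NonUnitalStarSubalgebra ℂ A where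
  carrier := {x | x ∈ I ∧ star x ∈ I}
  add_mem' hx hy := ⟨I.add_mem hx.1 hy.1, by simpa using I.add_mem hx.2 hy.2⟩
  zero_mem' := by simp
  mul_mem' {x y} hx hy := ⟨hI x y hy.1, by simpa using hI (star y) (star x) hx.2⟩
  smul_mem' c x hx := ⟨I.smul_mem c hx.1, by simpa using I.smul_mem (star c) hx.2⟩
  star_mem' hx := ⟨hx.2, by simpa using hx.1⟩

lemma Submodule.isClosed_starCore {A : Type*} [NonUnitalCStarAlgebra A] (I : Submodule ℂ A)
    (hI : ∀ a : A, ∀ x ∈ I, a * x ∈ I) (hc : IsClosed (I : Set A)) :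
    IsClosed (I.starCore hI : Set A) :=
  hc.inter (hc.preimage continuous_star)

/-- The image of the canonical approximate unit of a C*-algebra under a star homomorphism, as an
increasing net. -/
lemma exists_monotone_net_map_approximateUnit {A : Type v} {B : Type w}
    [NonUnitalCStarAlgebra A] [NonUnitalCStarAlgebra B] [PartialOrder A] [StarOrderedRing A]
    (φ : B →⋆ₙₐ[ℂ] A) :
    ∃ (ι : Type w) (_ : Preorder ι) (_ : IsDirected ι (· ≤ ·)) (_ : Nonempty ι) (u : ι → B),
      (∀ i, 0 ≤ φ (u i)) ∧ (∀ i, ‖u i‖ ≤ 1) ∧ Monotone (fun i => φ (u i)) ∧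
        ∀ x, Tendsto (fun i => u i * x) atTop (𝓝 x) := by
  let := CStarAlgebra.spectralOrder B
  have := CStarAlgebra.spectralOrderedRing B
  have hdir : IsDirectedOrder ↥({x : B | 0 ≤ x} ∩ Metric.ball 0 1) :=
    CStarAlgebra.directedOn_nonneg_ball.isDirectedOrder
  have hne : Nonempty ↥({x : B | 0 ≤ x} ∩ Metric.ball 0 1) := ⟨⟨0, by simp⟩⟩
  refine ⟨↥({x : B | 0 ≤ x} ∩ Metric.ball 0 1), inferInstance, hdir, hne, Subtype.val,
    fun i => map_nonneg φ i.2.1, fun i => ?_, fun i j hij => ?_, fun x => ?_⟩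
  · have := i.2.2
    rw [mem_ball_zero_iff] at this
    exact this.le
  · exact OrderHomClass.mono φ hij
  · refine ((CStarAlgebra.increasingApproximateUnit B).tendsto_mul_right x).comp ?_
    rw [(CStarAlgebra.hasBasis_approximateUnit B).tendsto_right_iff]
    rintro a ⟨ha, ha'⟩
    filter_upwards [eventually_ge_atTop
      (⟨a, ha, by simpa using ha'⟩ : ↥({x : B | 0 ≤ x} ∩ Metric.ball 0 1))] with i hi
    exact ⟨hi, Metric.ball_subset_closedBall i.2.2⟩

/-- If `x*x - u x*x → 0` along contractive self-adjoint `u`, then `u x* → x*`. -/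
lemma tendsto_mul_star_of_tendsto_mul_star_mul_self {A : Type*} [NonUnitalCStarAlgebra A]
    {ι : Type*} {l : Filter ι} {u : ι → A} {x : A} (hu : ∀ i, IsSelfAdjoint (u i))
    (hu₁ : ∀ i, ‖u i‖ ≤ 1) (h : Tendsto (fun i => u i * (star x * x)) l (𝓝 (star x * x))) :
    Tendsto (fun i => u i * star x) l (𝓝 (star x)) := by
  rw [tendsto_iff_norm_sub_tendsto_zero] at h ⊢
  have hsq : Tendsto (fun i => ‖u i * star x - star x‖ ^ 2) l (𝓝 0) := by
    refine squeeze_zero (fun i => by positivity) (fun i => ?_) (by simpa using h.mul_const 2)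
    set d := u i * (star x * x) - star x * x
    have hd : (u i * star x - star x) * star (u i * star x - star x) = d * u i - d := by
      simp only [d, star_sub, star_mul, star_star, (hu i).star_eq]
      noncomm_ring
    calc ‖u i * star x - star x‖ ^ 2 = ‖d * u i - d‖ := by
          rw [← hd, CStarRing.norm_self_mul_star, sq]
      _ ≤ ‖d‖ * ‖u i‖ + ‖d‖ := (norm_sub_le _ _).trans (by gcongr; exact norm_mul_le _ _)
      _ ≤ ‖d‖ * 1 + ‖d‖ := by gcongr; exact hu₁ i
      _ = ‖d‖ * 2 := by ring
  simpa [Real.sqrt_sq_eq_abs] using hsq.sqrt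

/-- A closed two-sided ideal is star-closed, and it has an increasing
approximate unit indexed by a type in the universe of the algebra. -/
lemma star_mem_and_exists_isApproxUnit {A : Type v} [NonUnitalCStarAlgebra A] [PartialOrder A]
    [StarOrderedRing A] (I : Submodule ℂ A) (hl : ∀ a : A, ∀ x ∈ I, a * x ∈ I)
    (hr : ∀ a : A, ∀ x ∈ I, x * a ∈ I) (hc : IsClosed (I : Set A)) :
    (∀ x ∈ I, star x ∈ I) ∧
      ∃ (ι : Type v) (_ : Preorder ι) (_ : IsDirected ι (· ≤ ·)) (_ : Nonempty ι) (u : ι → A),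
        IsApproxUnit I u := by
  have := I.isClosed_starCore hl hc
  obtain ⟨ι, _, _, _, u, hu₀, hu₁, hu₂, hu⟩ := exists_monotone_net_map_approximateUnit
    (NonUnitalStarSubalgebraClass.subtype (I.starCore hl))
  have hu' : ∀ x ∈ I.starCore hl, Tendsto (fun i => (u i : A) * x) atTop (𝓝 x) := fun x hx =>
    (continuous_subtype_val.tendsto _).comp (hu ⟨x, hx⟩)
  have hstar : ∀ x ∈ I, star x ∈ I := fun x hx =>
    hc.mem_of_tendsto
      (tendsto_mul_star_of_tendsto_mul_star_mul_self (fun i => IsSelfAdjoint.of_nonneg (hu₀ i)) hu₁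
        (hu' _ ⟨hl _ _ hx, by simpa using hl _ _ hx⟩))
      (Eventually.of_forall fun i => hr _ _ (u i).2.1)
  exact ⟨hstar, ι, inferInstance, inferInstance, inferInstance, fun i => u i,
    { mem := fun i => (u i).2.1
      nonneg := hu₀
      norm_le_one := hu₁
      mono := hu₂
      approx := fun x hx => tendsto_iff_norm_sub_tendsto_zero.1 (hu' x ⟨hx, hstar x hx⟩) }⟩

namespace IsApproxUnit

variable {A : Type v} [NonUnitalCStarAlgebra A] [PartialOrder A] [StarOrderedRing A]
  {ι : Type x} [Preorder ι] {I : Submodule ℂ A} {u : ι → A}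

lemma tendsto_mul_right (hu : IsApproxUnit I u) {x : A} (hx : x ∈ I) :
    Tendsto (fun i => u i * x) atTop (𝓝 x) :=
  tendsto_iff_norm_sub_tendsto_zero.2 (hu.approx x hx)

lemma tendsto_mul_left (hu : IsApproxUnit I u) {x : A} (hx : star x ∈ I) :
    Tendsto (fun i => x * u i) atTop (𝓝 x) := by
  simpa [(IsSelfAdjoint.of_nonneg (hu.nonneg _)).star_eq] using (hu.tendsto_mul_right hx).star

end IsApproxUnit

namespace CStarPartialAction

variable {G : Type u} [Group G] {A : Type v} [NonUnitalCStarAlgebra A]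

lemma star_mem (α : CStarPartialAction G A) (t : G) {x : A} (hx : x ∈ α.ideal t) :
    star x ∈ α.ideal t := by
  let := CStarAlgebra.spectralOrder A
  have := CStarAlgebra.spectralOrderedRing A
  exact (star_mem_and_exists_isApproxUnit _ (α.mul_mem_left t) (α.mul_mem_right t)
    (α.ideal_closed t)).1 x hx

/-- The ideal `A_t` as a star subalgebra. -/
def starIdeal (α : CStarPartialAction G A) (t : G) : NonUnitalStarSubalgebra ℂ A where
  __ := α.ideal t
  mul_mem' {x y} _ hy := α.mul_mem_left t x y hy
  star_mem' hx := α.star_mem t hx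

/-- The map `α_t : A_{t⁻¹} → A` as a star homomorphism. -/
def actHom (α : CStarPartialAction G A) (t : G) : α.starIdeal t⁻¹ →⋆ₙₐ[ℂ] A where
  toFun x := α.act t x
  map_smul' c x := α.act_smul t c x x.2
  map_zero' := by simpa using α.act_smul t 0 0 (zero_mem _)
  map_add' x y := α.act_add t x x.2 y y.2
  map_mul' x y := α.act_mul t x x.2 y y.2
  map_star' x := α.act_star t x x.2

lemma continuousOn_act (α : CStarPartialAction G A) (t : G) :
    ContinuousOn (α.act t) (α.ideal t⁻¹) := by
  have : IsClosed (α.starIdeal t⁻¹ : Set A) := α.ideal_closed t⁻¹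
  rw [continuousOn_iff_continuous_domRestrict]
  exact AddMonoidHomClass.continuous_of_bound (α.actHom t) 1 fun x => by
    simpa using! NonUnitalStarAlgHom.norm_apply_le (α.actHom t) x

lemma tendsto_act (α : CStarPartialAction G A) (t : G) {ι : Type*} {l : Filter ι} {z : ι → A}
    {y : A} (hz : ∀ i, z i ∈ α.ideal t⁻¹) (hy : y ∈ α.ideal t⁻¹) (h : Tendsto z l (𝓝 y)) :
    Tendsto (fun i => α.act t (z i)) l (𝓝 (α.act t y)) :=
  (α.continuousOn_act t y hy).tendsto.comp
    (tendsto_nhdsWithin_iff.2 ⟨h, Eventually.of_forall hz⟩)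

lemma act_inv_mem (α : CStarPartialAction G A) (t : G) {c : A} (hc : c ∈ α.ideal t) :
    α.act t⁻¹ c ∈ α.ideal t⁻¹ :=
  α.act_mem t⁻¹ c (by simpa using hc)

lemma act_act_inv (α : CStarPartialAction G A) (t : G) {c : A} (hc : c ∈ α.ideal t) :
    α.act t (α.act t⁻¹ c) = c := by
  rw [α.act_comp t t⁻¹ c (by simpa using hc) (α.act_inv_mem t hc), mul_inv_cancel, α.act_one]

variable [PartialOrder A] [StarOrderedRing A]

/-- A limit of `α_t(u_i a) b` along an approximate unit lies in `A_t`, and its products with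
elements of `A_t` are determined by `α`, `a` and `b`. -/
lemma mem_and_mul_eq_of_tendsto (α : CStarPartialAction G A) {t : G} {a b z : A} {ι : Type x}
    [Preorder ι] [IsDirected ι (· ≤ ·)] [Nonempty ι] {u : ι → A}
    (hu : IsApproxUnit (α.ideal t⁻¹) u)
    (hz : Tendsto (fun i => α.act t (u i * a) * b) atTop (𝓝 z)) :
    z ∈ α.ideal t ∧ ∀ c ∈ α.ideal t, c * z = α.act t (α.act t⁻¹ c * a) * b ∧
      z * c = α.act t (a * α.act t⁻¹ (b * c)) := by
  have hua : ∀ i, u i * a ∈ α.ideal t⁻¹ := fun i => α.mul_mem_right _ _ _ (hu.mem i)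
  refine ⟨(α.ideal_closed t).mem_of_tendsto hz (Eventually.of_forall fun i =>
    α.mul_mem_right _ _ _ (α.act_mem t _ (hua i))), fun c hc => ⟨?_, ?_⟩⟩
  · have hd := α.act_inv_mem t hc
    refine tendsto_nhds_unique (hz.const_mul c) ?_
    have h := (α.tendsto_act t (fun i => α.mul_mem_left _ (α.act t⁻¹ c) _ (hua i))
      (α.mul_mem_right _ a _ hd)
      (by simpa [mul_assoc] using
        (hu.tendsto_mul_left (α.star_mem _ hd)).mul_const a)).mul_const b
    refine h.congr fun i => ?_
    rw [α.act_mul t _ hd _ (hua i), α.act_act_inv t hc, mul_assoc]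
  · have hbc := α.mul_mem_left t b c hc
    have hd := α.act_inv_mem t hbc
    refine tendsto_nhds_unique (hz.mul_const c) ?_
    have had := α.mul_mem_left _ a _ hd
    refine (α.tendsto_act t (fun i => α.mul_mem_left _ (u i) _ had) had
      (hu.tendsto_mul_right had)).congr fun i => ?_
    rw [← mul_assoc, α.act_mul t _ (hua i) _ hd, α.act_act_inv t hbc, mul_assoc]

lemma eq_of_forall_mul_eq (α : CStarPartialAction G A) {t : G} {y z : A} (hy : y ∈ α.ideal t)
    (hz : z ∈ α.ideal t) (h : ∀ c ∈ α.ideal t, c * y = c * z) : y = z := by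
  rw [← sub_eq_zero, ← CStarRing.star_mul_self_eq_zero_iff, mul_sub, sub_eq_zero]
  exact h _ (α.star_mem t (sub_mem hy hz))

end CStarPartialAction

/-- If `α` has property (NS), then for all `t ∈ G`, `a, b ∈ A` there is a
(unique) `x = F_t(a,b) ∈ A_t` which is the limit of `(α_t(u_i a) b)` for *every* approximate
unit `(u_i)` of `A_{t⁻¹}` (so the limit is independent of the approximate unit), and which
satisfies `c·x = α_t(α_{t⁻¹}(c)a)b` and `x·c = α_t(a·α_{t⁻¹}(bc))` for every `c ∈ A_t`. -/
theorem NS_limit_independent_and_module_property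
    {G : Type u} [Group G] {A : Type v} [NonUnitalCStarAlgebra A]
    [PartialOrder A] [StarOrderedRing A]
    (α : CStarPartialAction G A) (hNS : HasNS α) (t : G) (a b : A) :
    ∃ x : A, x ∈ α.ideal t ∧
      (∀ (ι : Type v) [Preorder ι] [IsDirected ι (· ≤ ·)] [Nonempty ι],
        ∀ u : ι → A, IsApproxUnit (α.ideal t⁻¹) u →
          Filter.Tendsto (fun i => α.act t (u i * a) * b) Filter.atTop (nhds x)) ∧
      (∀ c ∈ α.ideal t,
        c * x = α.act t (α.act t⁻¹ c * a) * b ∧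
        x * c = α.act t (a * α.act t⁻¹ (b * c))) := by
  obtain ⟨-, ι₀, _, _, _, u₀, hu₀⟩ := star_mem_and_exists_isApproxUnit _ (α.mul_mem_left t⁻¹)
    (α.mul_mem_right t⁻¹) (α.ideal_closed t⁻¹)
  obtain ⟨x, hx⟩ := hNS t a b ι₀ u₀ hu₀
  obtain ⟨hxt, hxc⟩ := α.mem_and_mul_eq_of_tendsto hu₀ hx
  refine ⟨x, hxt, fun ι _ _ _ u hu => ?_, hxc⟩
  obtain ⟨y, hy⟩ := hNS t a b ι u hu
  obtain ⟨hyt, hyc⟩ := α.mem_and_mul_eq_of_tendsto hu hy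
  rwa [α.eq_of_forall_mul_eq hxt hyt fun c hc => (hxc c hc).1.trans (hyc c hc).1.symm]
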